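/- (Liminf inequality in the rate-independent limit, for absolutely continuous limits.) Let A > 0, let β_n → ∞ and α_n := e^{−β_n A}. Let x_n ∈ W^{1,1}(0,T) satisfy sup_n ∫₀ᵀ |ẋ_n(t)| dt < ∞ and x_n(t) → x(t) for every t ∈ [0,T], where x ∈ W^{1,1}(0,T), and suppose liminf_n J_{α_n,β_n}(x_n) < ∞. Then |∇E(x(t),t)| ≤ A for a.e. t ∈ (0,T), and liminf_{n→∞} J_{α_n,β_n}(x_n) ≥ A·∫₀ᵀ |ẋ(t)| dt + E(x(T),T) − E(x(0),0) − ∫₀ᵀ ∂_t E(x(t),t) dt. -/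

import Mathlib

open MeasureTheory Real Filter Topology Set

/-- `ψ_{α,β}(v)`, the dissipation potential from Kramers' rates. -/
noncomputable def psi (a b v : ℝ) : ℝ :=
  v / b * Real.log ((v + Real.sqrt (v ^ 2 + 4 * a ^ 2)) / (2 * a))
    - 1 / b * Real.sqrt (v ^ 2 + 4 * a ^ 2) + 2 * a / b

/-- `ψ*_{α,β}(w)`, the dual dissipation potential. -/
noncomputable def psiStar (a b w : ℝ) : ℝ :=
  2 * a / b * (Real.cosh (b * w) - 1)

theorem sinh_mul_sub_le_cosh_sub_cosh (u s : ℝ) :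
    Real.sinh u * (s - u) ≤ Real.cosh s - Real.cosh u := by
  have h1 : Real.exp u * (s - u + 1) ≤ Real.exp s := by
    have h := mul_le_mul_of_nonneg_left (Real.add_one_le_exp (s - u)) (Real.exp_pos u).le
    rwa [← Real.exp_add, add_sub_cancel] at h
  have h2 : Real.exp (-u) * (u - s + 1) ≤ Real.exp (-s) := by
    have h := mul_le_mul_of_nonneg_left (Real.add_one_le_exp (u - s)) (Real.exp_pos (-u)).le
    rwa [← Real.exp_add, show -u + (u - s) = -s by ring] at h
  rw [Real.sinh_eq, Real.cosh_eq, Real.cosh_eq]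
  linarith

theorem psi_two_mul_sinh {a b : ℝ} (ha : 0 < a) (u : ℝ) :
    psi a b (2 * a * Real.sinh u) =
      2 * a / b * (Real.sinh u * u - Real.cosh u + 1) := by
  have hsq : Real.sqrt ((2 * a * Real.sinh u) ^ 2 + 4 * a ^ 2) = 2 * a * Real.cosh u := by
    rw [Real.sqrt_eq_iff_mul_self_eq (by positivity)
      (mul_nonneg (by positivity) (Real.cosh_pos u).le)]
    linear_combination -4 * a ^ 2 * Real.cosh_sq u
  have hexp : (2 * a * Real.sinh u + 2 * a * Real.cosh u) / (2 * a) = Real.exp u := by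
    rw [← Real.sinh_add_cosh]
    field_simp
  rw [psi, hsq, hexp, Real.log_exp]
  ring

/-- The Fenchel–Young inequality for `psi` and `psiStar`. -/
theorem mul_le_psi_add_psiStar {a b : ℝ} (ha : 0 < a) (hb : 0 < b) (v w : ℝ) :
    v * w ≤ psi a b v + psiStar a b w := by
  obtain ⟨u, rfl⟩ : ∃ u, 2 * a * Real.sinh u = v :=
    ⟨Real.arsinh (v / (2 * a)), by rw [Real.sinh_arsinh]; field_simp⟩
  have h := mul_le_mul_of_nonneg_left (sinh_mul_sub_le_cosh_sub_cosh u (b * w))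
    (show 0 ≤ 2 * a / b by positivity)
  rw [psi_two_mul_sinh ha, psiStar]
  have e : 2 * a / b * (Real.sinh u * (b * w - u)) =
      2 * a * Real.sinh u * w - 2 * a / b * (Real.sinh u * u) := by
    field_simp
  linarith

theorem psiStar_nonneg {a b : ℝ} (ha : 0 < a) (hb : 0 < b) (w : ℝ) : 0 ≤ psiStar a b w :=
  mul_nonneg (by positivity) (sub_nonneg.2 (Real.one_le_cosh _))

theorem psi_nonneg {a b : ℝ} (ha : 0 < a) (hb : 0 < b) (v : ℝ) : 0 ≤ psi a b v := by
  simpa [psiStar] using mul_le_psi_add_psiStar ha hb v 0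

theorem psiStar_exp_le {A b : ℝ} (hA : 0 < A) (hb : 0 < b) :
    psiStar (Real.exp (-b * A)) b A ≤ 2 / b := by
  have hc : Real.cosh (b * A) ≤ Real.exp (b * A) := by
    have : Real.exp (-(b * A)) ≤ Real.exp (b * A) :=
      Real.exp_le_exp.2 (by nlinarith [mul_pos hb hA])
    rw [Real.cosh_eq]
    linarith
  have he : Real.exp (-b * A) * Real.exp (b * A) = 1 := by
    rw [← Real.exp_add]
    simp
  calc psiStar (Real.exp (-b * A)) b A
      ≤ 2 * Real.exp (-b * A) / b * Real.exp (b * A) := by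
        unfold psiStar
        gcongr
        linarith
    _ = 2 / b * (Real.exp (-b * A) * Real.exp (b * A)) := by ring
    _ = 2 / b := by rw [he, mul_one]

theorem mul_abs_sub_le_psi {A b : ℝ} (hA : 0 < A) (hb : 0 < b) (v : ℝ) :
    A * |v| - 2 / b ≤ psi (Real.exp (-b * A)) b v := by
  have h := psiStar_exp_le hA hb
  have hneg : psiStar (Real.exp (-b * A)) b (-A) = psiStar (Real.exp (-b * A)) b A := by
    simp [psiStar]
  rcases le_total 0 v with hv | hv
  · have := mul_le_psi_add_psiStar (Real.exp_pos (-b * A)) hb v A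
    rw [abs_of_nonneg hv]
    linarith
  · have := mul_le_psi_add_psiStar (Real.exp_pos (-b * A)) hb v (-A)
    rw [abs_of_nonpos hv]
    linarith

theorem le_psiStar_exp {A b d w : ℝ} (hA : 0 < A) (hb : 1 ≤ b) (hd : 0 ≤ d)
    (hw : A + d ≤ |w|) :
    b * (d ^ 2 / 2) - 2 ≤ psiStar (Real.exp (-b * A)) b w := by
  have hb0 : 0 < b := by linarith
  have hcosh : Real.exp (b * (A + d)) / 2 ≤ Real.cosh (b * w) := by
    rw [← Real.cosh_abs, abs_mul, abs_of_pos hb0, Real.cosh_eq]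
    have : Real.exp (b * (A + d)) ≤ Real.exp (b * |w|) := by gcongr
    linarith [Real.exp_pos (-(b * |w|))]
  have hq := Real.quadratic_le_exp_of_nonneg (mul_nonneg hb0.le hd)
  have ha1 : Real.exp (-b * A) ≤ 1 := Real.exp_le_one_iff.2 (by nlinarith)
  have he : Real.exp (-b * A) * Real.exp (b * (A + d)) = Real.exp (b * d) := by
    rw [← Real.exp_add]
    ring_nf
  have hstep : Real.exp (b * d) - 2 ≤ 2 * Real.exp (-b * A) * (Real.cosh (b * w) - 1) := by
    nlinarith [mul_le_mul_of_nonneg_left hcosh (Real.exp_pos (-b * A)).le]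
  have hrw : psiStar (Real.exp (-b * A)) b w =
      2 * Real.exp (-b * A) * (Real.cosh (b * w) - 1) / b := by
    unfold psiStar
    ring
  rw [hrw, le_div_iff₀ hb0]
  nlinarith [mul_nonneg hb0.le hd]

theorem lintegral_enorm_le_of_tendsto {X : Type*} [MeasurableSpace X] {μ : Measure X}
    {f : ℕ → X → ℝ} {g : X → ℝ} {C : ENNReal} (hf : ∀ n, AEStronglyMeasurable (f n) μ)
    (hlim : ∀ᵐ t ∂μ, Tendsto (fun n => f n t) atTop (𝓝 (g t)))
    (hC : ∀ᶠ n in atTop, ∫⁻ t, ‖f n t‖ₑ ∂μ ≤ C) : ∫⁻ t, ‖g t‖ₑ ∂μ ≤ C :=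
  calc ∫⁻ t, ‖g t‖ₑ ∂μ = ∫⁻ t, liminf (fun n => ‖f n t‖ₑ) atTop ∂μ :=
        lintegral_congr_ae (hlim.mono fun t ht => ht.enorm.liminf_eq.symm)
    _ ≤ liminf (fun n => ∫⁻ t, ‖f n t‖ₑ ∂μ) atTop := lintegral_liminf_le' fun n => (hf n).enorm
    _ ≤ C := by
        refine (liminf_le_liminf hC).trans ?_
        simp

theorem lintegral_enorm_difference_quotient_le {v : ℝ → ℝ} (hv : Integrable v) {h : ℝ}
    (hh : 0 < h) :
    ∫⁻ t, ‖h⁻¹ * ∫ s in t..t + h, v s‖ₑ ≤ ∫⁻ t, ‖v t‖ₑ := by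
  have hpt (t : ℝ) : ‖h⁻¹ * ∫ s in t..t + h, v s‖ₑ ≤
      ‖h⁻¹‖ₑ * ∫⁻ s in Ioc 0 h, ‖v (t + s)‖ₑ := by
    have : ∫ s in t..t + h, v s = ∫ s in Ioc 0 h, v (t + s) := by
      rw [← intervalIntegral.integral_of_le hh.le, intervalIntegral.integral_comp_add_left]
      simp
    rw [this, enorm_mul]
    gcongr
    exact enorm_integral_le_lintegral_enorm _
  have hmeas : AEMeasurable (Function.uncurry fun t s : ℝ => ‖v (t + s)‖ₑ)
      (volume.prod (volume.restrict (Ioc 0 h))) := by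
    have hq : Measure.QuasiMeasurePreserving (fun p : ℝ × ℝ => p.1 + p.2)
        (volume.prod (volume.restrict (Ioc 0 h))) volume :=
      (quasiMeasurePreserving_add volume volume).mono_left
        (Measure.AbsolutelyContinuous.prod Measure.AbsolutelyContinuous.rfl
          Measure.restrict_le_self.absolutelyContinuous)
    exact (hv.aestronglyMeasurable.enorm.comp_quasiMeasurePreserving hq)
  calc ∫⁻ t, ‖h⁻¹ * ∫ s in t..t + h, v s‖ₑ
      ≤ ∫⁻ t, ‖h⁻¹‖ₑ * ∫⁻ s in Ioc 0 h, ‖v (t + s)‖ₑ := lintegral_mono hpt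
    _ = ‖h⁻¹‖ₑ * ∫⁻ t, ∫⁻ s in Ioc 0 h, ‖v (t + s)‖ₑ :=
        lintegral_const_mul' _ _ enorm_ne_top
    _ = ‖h⁻¹‖ₑ * ∫⁻ s in Ioc 0 h, ∫⁻ t, ‖v (t + s)‖ₑ := by rw [lintegral_lintegral_swap hmeas]
    _ = ‖h⁻¹‖ₑ * ∫⁻ s in Ioc 0 h, ∫⁻ t, ‖v t‖ₑ := by
        congr 2
        ext s
        exact lintegral_add_right_eq_self (fun t => ‖v t‖ₑ) s
    _ = (‖h⁻¹‖ₑ * ENNReal.ofReal h) * ∫⁻ t, ‖v t‖ₑ := by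
        rw [lintegral_const, Measure.restrict_apply_univ, Real.volume_Ioc, sub_zero]
        ring
    _ = ∫⁻ t, ‖v t‖ₑ := by
        rw [Real.enorm_of_nonneg (by positivity), ← ENNReal.ofReal_mul (by positivity),
          inv_mul_cancel₀ hh.ne']
        simp

/-- Lower semicontinuity of the `L¹` norm under pointwise convergence of primitives. -/
theorem lintegral_enorm_le_of_tendsto_primitive {v : ℕ → ℝ → ℝ} {w : ℝ → ℝ} {C : ENNReal}
    (hv : ∀ n, Integrable (v n)) (hw : Integrable w)
    (hlim : ∀ t, Tendsto (fun n => ∫ s in (0 : ℝ)..t, v n s) atTop (𝓝 (∫ s in (0 : ℝ)..t, w s)))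
    (hC : ∀ᶠ n in atTop, ∫⁻ t, ‖v n t‖ₑ ≤ C) : ∫⁻ t, ‖w t‖ₑ ≤ C := by
  have hsub {u : ℝ → ℝ} (hu : Integrable u) (a b : ℝ) :
      (∫ s in (0 : ℝ)..b, u s) - ∫ s in (0 : ℝ)..a, u s = ∫ s in a..b, u s :=
    intervalIntegral.integral_interval_sub_left hu.intervalIntegrable hu.intervalIntegrable
  have hquot {u : ℝ → ℝ} (hu : Integrable u) (h : ℝ) :
      AEStronglyMeasurable (fun t => h⁻¹ * ∫ s in t..t + h, u s) := by
    have hc := intervalIntegral.continuous_primitive (fun _ _ => hu.intervalIntegrable) 0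
    have hq : Continuous fun t =>
        h⁻¹ * ((∫ s in (0 : ℝ)..t + h, u s) - ∫ s in (0 : ℝ)..t, u s) :=
      continuous_const.mul ((hc.comp (continuous_id.add continuous_const)).sub hc)
    simpa only [hsub hu] using hq.aestronglyMeasurable
  have hquotC {h : ℝ} (hh : 0 < h) : ∫⁻ t, ‖h⁻¹ * ∫ s in t..t + h, w s‖ₑ ≤ C := by
    refine lintegral_enorm_le_of_tendsto (fun n => hquot (hv n) h)
      (ae_of_all _ fun t => Tendsto.const_mul _ ?_)
      (hC.mono fun n hn => (lintegral_enorm_difference_quotient_le (hv n) hh).trans hn)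
    simpa only [hsub (hv _), hsub hw] using (hlim (t + h)).sub (hlim t)
  refine lintegral_enorm_le_of_tendsto
    (f := fun n t => ((1 / ((n : ℝ) + 1))⁻¹ * ∫ s in t..t + 1 / ((n : ℝ) + 1), w s))
    (fun n => hquot hw _) ?_ (Eventually.of_forall fun n => hquotC (by positivity))
  filter_upwards [LocallyIntegrable.ae_hasDerivAt_integral hw.locallyIntegrable] with t ht
  have hs := (ht 0).tendsto_slope_zero_right
  have h0 : Tendsto (fun n : ℕ => 1 / ((n : ℝ) + 1)) atTop (𝓝[>] 0) :=
    tendsto_nhdsWithin_iff.2 ⟨tendsto_one_div_add_atTop_nhds_zero_nat,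
      Eventually.of_forall fun n => by simp only [mem_Ioi]; positivity⟩
  have := hs.comp h0
  simpa only [Function.comp_def, smul_eq_mul, hsub hw] using this

theorem intervalIntegrable_of_integrableOn_Ioo {u : ℝ → ℝ} {T : ℝ} (hT : 0 ≤ T)
    (hu : IntegrableOn u (Ioo 0 T)) : IntervalIntegrable u volume 0 T := by
  rwa [intervalIntegrable_iff_integrableOn_Ioo_of_le hT]

theorem intervalIntegral_indicator_eq_clamp {T : ℝ} (hT : 0 ≤ T) (u : ℝ → ℝ) (t : ℝ) :
    ∫ s in (0 : ℝ)..t, (Ioc 0 T).indicator u s = ∫ s in (0 : ℝ)..max 0 (min t T), u s := by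
  rcases le_total 0 t with ht | ht
  · rw [max_eq_right (le_min ht hT), intervalIntegral.integral_of_le ht,
      intervalIntegral.integral_of_le (le_min ht hT), setIntegral_indicator measurableSet_Ioc,
      Ioc_inter_Ioc, sup_idem]
  · rw [max_eq_left ((min_le_left t T).trans ht), intervalIntegral.integral_of_ge ht,
      setIntegral_indicator measurableSet_Ioc, Ioc_inter_Ioc, Ioc_eq_empty (by simp)]
    simp

theorem integral_abs_le_of_tendsto_primitive {T C : ℝ} (hT : 0 ≤ T) {u : ℕ → ℝ → ℝ}
    {w : ℝ → ℝ} (hu : ∀ n, IntegrableOn (u n) (Ioo 0 T)) (hw : IntegrableOn w (Ioo 0 T))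
    (hlim : ∀ t ∈ Icc 0 T,
      Tendsto (fun n => ∫ s in (0 : ℝ)..t, u n s) atTop (𝓝 (∫ s in (0 : ℝ)..t, w s)))
    (hC : ∀ᶠ n in atTop, ∫ t in Ioo 0 T, |u n t| ≤ C) : ∫ t in Ioo 0 T, |w t| ≤ C := by
  have hind {f : ℝ → ℝ} (hf : IntegrableOn f (Ioo 0 T)) :
      Integrable ((Ioc 0 T).indicator f) ∧
        ∫⁻ t, ‖(Ioc 0 T).indicator f t‖ₑ = ENNReal.ofReal (∫ t in Ioo 0 T, |f t|) := by
    have hf' : IntegrableOn f (Ioc 0 T) := by rwa [integrableOn_Ioc_iff_integrableOn_Ioo]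
    refine ⟨hf'.integrable_indicator measurableSet_Ioc, ?_⟩
    rw [← integral_Ioc_eq_integral_Ioo]
    simp_rw [enorm_indicator_eq_indicator_enorm, ← Real.norm_eq_abs]
    rw [lintegral_indicator measurableSet_Ioc, ofReal_integral_norm_eq_lintegral_enorm hf']
  have h0 : 0 ≤ C := by
    obtain ⟨n, hn⟩ := hC.exists
    exact (integral_nonneg fun t => abs_nonneg (u n t)).trans hn
  have key := lintegral_enorm_le_of_tendsto_primitive (C := ENNReal.ofReal C)
    (fun n => (hind (hu n)).1) (hind hw).1 (fun t => by
      simp_rw [intervalIntegral_indicator_eq_clamp hT]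
      exact hlim _ ⟨le_max_left _ _, max_le hT (min_le_right _ _)⟩)
    (hC.mono fun n hn => by
      rw [(hind (hu n)).2]
      exact ENNReal.ofReal_le_ofReal hn)
  rw [(hind hw).2] at key
  exact (ENNReal.ofReal_le_ofReal_iff h0).1 key

theorem exists_bound_on_box {F : ℝ → ℝ → ℝ} (hF : Continuous fun p : ℝ × ℝ => F p.1 p.2)
    (M T : ℝ) : ∃ K, 0 ≤ K ∧ ∀ y t, |y| ≤ M → t ∈ Icc 0 T → |F y t| ≤ K := by
  obtain ⟨K, hK⟩ := ((isCompact_Icc (a := -M) (b := M)).prod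
    (isCompact_Icc (a := (0 : ℝ)) (b := T))).exists_bound_of_continuousOn hF.continuousOn
  refine ⟨max K 0, le_max_right _ _, fun y t hy ht => ?_⟩
  exact (hK (y, t) ⟨abs_le.1 hy, ht⟩).trans (le_max_left _ _)

/-- A map that is Lipschitz in `(y, t)` composed with an absolutely continuous curve is absolutely
continuous. -/
theorem absolutelyContinuousOnInterval_of_dist_le {f y : ℝ → ℝ} {a b R K : ℝ}
    (hy : AbsolutelyContinuousOnInterval y a b)
    (hf : ∀ s ∈ uIcc a b, ∀ t ∈ uIcc a b, dist (f s) (f t) ≤ R * dist (y s) (y t) + K * dist s t) :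
    AbsolutelyContinuousOnInterval f a b := by
  have hid : AbsolutelyContinuousOnInterval (fun t : ℝ => t) a b :=
    LipschitzOnWith.absolutelyContinuousOnInterval (K := 1) LipschitzWith.id.lipschitzOnWith
  unfold AbsolutelyContinuousOnInterval at *
  refine squeeze_zero' (Eventually.of_forall fun I => Finset.sum_nonneg fun i _ => dist_nonneg)
    ?_ (by simpa using (hy.const_mul R).add (hid.const_mul K))
  filter_upwards [mem_inf_of_right (mem_principal_self _)] with I hI
  rw [Finset.mul_sum, Finset.mul_sum, ← Finset.sum_add_distrib]
  exact Finset.sum_le_sum fun i hi => hf _ (hI.1 i hi).1 _ (hI.1 i hi).2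

theorem hasDerivAt_comp_curve {E DE Et : ℝ → ℝ → ℝ}
    (hDEcont : Continuous fun p : ℝ × ℝ => DE p.1 p.2)
    (hEtcont : Continuous fun p : ℝ × ℝ => Et p.1 p.2)
    (hDE : ∀ y t, HasDerivAt (fun z => E z t) (DE y t) y)
    (hEt : ∀ y t, HasDerivAt (fun τ => E y τ) (Et y t) t)
    {y : ℝ → ℝ} {y' t : ℝ} (hy : HasDerivAt y y' t) :
    HasDerivAt (fun s => E (y s) s) (y' * DE (y t) t + Et (y t) t) t := by
  let D (F : ℝ → ℝ → ℝ) (z s : ℝ) : ℝ →L[ℝ] ℝ := ContinuousLinearMap.toSpanSingleton ℝ (F z s)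
  have hD {F : ℝ → ℝ → ℝ} (hF : Continuous fun p : ℝ × ℝ => F p.1 p.2) :
      Continuous fun p : ℝ × ℝ => D F p.1 p.2 :=
    (ContinuousLinearMap.toSpanSingletonCLE (𝕜 := ℝ) (E := ℝ)).continuous.comp hF
  have h := hasStrictFDerivAt_uncurry_coprod (𝕜 := ℝ) (u := (y t, t)) (f := E)
    (f₁ := D DE) (f₂ := D Et)
    (Eventually.of_forall fun p => (hDE p.1 p.2).hasFDerivAt)
    (Eventually.of_forall fun p => (hEt p.1 p.2).hasFDerivAt)
    (hD hDEcont).continuousAt (hD hEtcont).continuousAt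
  have := HasFDerivAt.comp_hasDerivAt (f := fun s => (y s, s)) t h.hasFDerivAt
    (hy.prodMk (hasDerivAt_id t))
  simpa [D, Function.HasUncurry.uncurry, Function.comp_def] using this

theorem ae_hasDerivAt_primitive {T : ℝ} (hT : 0 ≤ T) {y' : ℝ → ℝ}
    (hy' : IntegrableOn y' (Ioo 0 T)) (c : ℝ) :
    ∀ᵐ t, t ∈ Icc 0 T → HasDerivAt (fun t => c + ∫ s in (0 : ℝ)..t, y' s) (y' t) t := by
  filter_upwards [(intervalIntegrable_of_integrableOn_Ioo hT hy').ae_hasDerivAt_integral]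
    with t ht htT
  rw [uIcc_of_le hT] at ht
  exact (ht htT 0 ⟨le_rfl, hT⟩).const_add c

theorem absolutelyContinuousOnInterval_primitive {T : ℝ} (hT : 0 ≤ T) {y' : ℝ → ℝ}
    (hy' : IntegrableOn y' (Ioo 0 T)) (c : ℝ) :
    AbsolutelyContinuousOnInterval (fun t => c + ∫ s in (0 : ℝ)..t, y' s) 0 T :=
  absolutelyContinuousOnInterval_of_dist_le (R := 1) (K := 0)
    ((intervalIntegrable_of_integrableOn_Ioo hT
      hy').absolutelyContinuousOnInterval_intervalIntegral left_mem_uIcc)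
    fun s _ t _ => by simp

/-- The chain rule for a `C¹` energy along a `W^{1,1}` curve, in integrated form. -/
theorem integral_chain_rule {T : ℝ} (hT : 0 ≤ T) {E DE Et : ℝ → ℝ → ℝ} {R : ℝ}
    (hDEcont : Continuous fun p : ℝ × ℝ => DE p.1 p.2)
    (hEtcont : Continuous fun p : ℝ × ℝ => Et p.1 p.2)
    (hDE : ∀ y t, HasDerivAt (fun z => E z t) (DE y t) y)
    (hEt : ∀ y t, HasDerivAt (fun τ => E y τ) (Et y t) t)
    (hDEbound : ∀ y t, |DE y t| ≤ R)
    {y y' : ℝ → ℝ} (hy' : IntegrableOn y' (Ioo 0 T))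
    (hy : ∀ t ∈ Icc 0 T, y t = y 0 + ∫ s in (0 : ℝ)..t, y' s) :
    ∫ t in Ioo 0 T, (y' t * DE (y t) t + Et (y t) t) = E (y T) T - E (y 0) 0 := by
  let Y (t : ℝ) : ℝ := y 0 + ∫ s in (0 : ℝ)..t, y' s
  have hYac : AbsolutelyContinuousOnInterval Y 0 T :=
    absolutelyContinuousOnInterval_primitive hT hy' _
  obtain ⟨M, hM⟩ := hYac.exists_bound
  obtain ⟨K, -, hK⟩ := exists_bound_on_box hEtcont M T
  have hfac : AbsolutelyContinuousOnInterval (fun t => E (Y t) t) 0 T := by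
    refine absolutelyContinuousOnInterval_of_dist_le (R := R) (K := K) hYac fun s hs t ht => ?_
    have h1 : ‖E (Y s) s - E (Y t) s‖ ≤ R * ‖Y s - Y t‖ :=
      convex_univ.norm_image_sub_le_of_norm_hasDerivWithin_le
        (fun z _ => (hDE z s).hasDerivWithinAt) (fun z _ => hDEbound z s) trivial trivial
    have h2 : ‖E (Y t) s - E (Y t) t‖ ≤ K * ‖s - t‖ := by
      have hM' := hM t ht
      rw [uIcc_of_le hT] at hs ht
      exact (convex_Icc (0 : ℝ) T).norm_image_sub_le_of_norm_hasDerivWithin_le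
        (fun τ _ => (hEt (Y t) τ).hasDerivWithinAt) (fun τ hτ => hK _ τ hM' hτ) ht hs
    simp only [Real.dist_eq, Real.norm_eq_abs] at *
    calc |E (Y s) s - E (Y t) t|
        = |(E (Y s) s - E (Y t) s) + (E (Y t) s - E (Y t) t)| := by ring_nf
      _ ≤ _ := (abs_add_le _ _).trans (add_le_add h1 h2)
  have hYy (t : ℝ) (ht : t ∈ Icc 0 T) : Y t = y t := (hy t ht).symm
  have hftc := hfac.integral_deriv_eq_sub
  rw [intervalIntegral.integral_of_le hT, integral_Ioc_eq_integral_Ioo,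
    hYy T ⟨hT, le_rfl⟩, hYy 0 ⟨le_rfl, hT⟩] at hftc
  rw [← hftc]
  refine setIntegral_congr_ae measurableSet_Ioo ?_
  filter_upwards [ae_hasDerivAt_primitive hT hy' (y 0)] with t ht htT
  have htI := Ioo_subset_Icc_self htT
  rw [(hasDerivAt_comp_curve hDEcont hEtcont hDE hEt (y := Y) (ht htI)).deriv, hYy t htI]

theorem continuousOn_of_eq_primitive {T : ℝ} (hT : 0 ≤ T) {y y' : ℝ → ℝ}
    (hy' : IntegrableOn y' (Ioo 0 T))
    (hy : ∀ t ∈ Icc 0 T, y t = y 0 + ∫ s in (0 : ℝ)..t, y' s) : ContinuousOn y (Icc 0 T) := by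
  have h := (absolutelyContinuousOnInterval_primitive hT hy' (y 0)).continuousOn
  rw [uIcc_of_le hT] at h
  exact h.congr hy

theorem abs_le_of_eq_primitive {T : ℝ} {y y' : ℝ → ℝ}
    (hy' : IntegrableOn y' (Ioo 0 T))
    (hy : ∀ t ∈ Icc 0 T, y t = y 0 + ∫ s in (0 : ℝ)..t, y' s) {t : ℝ} (ht : t ∈ Icc 0 T) :
    |y t| ≤ |y 0| + ∫ s in Ioo 0 T, |y' s| := by
  rw [hy t ht]
  refine (abs_add_le _ _).trans ?_
  gcongr
  refine (intervalIntegral.abs_integral_le_integral_abs ht.1).trans ?_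
  rw [intervalIntegral.integral_of_le ht.1, integral_Ioc_eq_integral_Ioo]
  exact setIntegral_mono_set hy'.abs (ae_of_all _ fun s => abs_nonneg (y' s))
    (Ioo_subset_Ioo_right ht.2).eventuallyLE

theorem aestronglyMeasurable_comp_curve {T : ℝ} (hT : 0 ≤ T) {F : ℝ → ℝ → ℝ}
    (hF : Continuous fun p : ℝ × ℝ => F p.1 p.2) {y y' : ℝ → ℝ}
    (hy' : IntegrableOn y' (Ioo 0 T))
    (hy : ∀ t ∈ Icc 0 T, y t = y 0 + ∫ s in (0 : ℝ)..t, y' s) :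
    AEStronglyMeasurable (fun t => F (y t) t) (volume.restrict (Ioo 0 T)) :=
  (hF.comp_continuousOn ((continuousOn_of_eq_primitive hT hy' hy).prodMk
    continuousOn_id)).mono Ioo_subset_Icc_self |>.aestronglyMeasurable measurableSet_Ioo

theorem ofReal_integral_le_lintegral_ofReal {X : Type*} [MeasurableSpace X] {μ : Measure X}
    {f : X → ℝ} (hf : Integrable f μ) :
    ENNReal.ofReal (∫ t, f t ∂μ) ≤ ∫⁻ t, ENNReal.ofReal (f t) ∂μ := by
  rw [integral_eq_lintegral_pos_part_sub_lintegral_neg_part hf]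
  exact (ENNReal.ofReal_le_ofReal (sub_le_self _ ENNReal.toReal_nonneg)).trans
    ENNReal.ofReal_toReal_le

theorem psiStar_le_rate_add {a b R v w : ℝ} (ha : 0 < a) (hb : 0 < b) (hw : |w| ≤ R) :
    psiStar a b w ≤ psi a b v + psiStar a b w + v * w + R * |v| := by
  have h1 : -(v * w) ≤ |v| * |w| := by
    rw [← abs_mul]
    exact neg_le_abs _
  have h2 : |v| * |w| ≤ |v| * R := by gcongr
  linarith [psi_nonneg ha hb v]

theorem psiStar_exp_tendsto_atTop {A w : ℝ} (hA : 0 < A) (hw : A < |w|) {b W : ℕ → ℝ}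
    (hb : Tendsto b atTop atTop) (hW : Tendsto W atTop (𝓝 w)) :
    Tendsto (fun n => psiStar (Real.exp (-b n * A)) (b n) (W n)) atTop atTop := by
  obtain ⟨d, hd, hdw⟩ : ∃ d, 0 < d ∧ A + d < |w| :=
    ⟨(|w| - A) / 2, by linarith, by linarith⟩
  refine tendsto_atTop_mono' atTop (f₁ := fun n => b n * (d ^ 2 / 2) - 2) ?_
    (tendsto_atTop_add_const_right _ _ (hb.atTop_mul_const (by positivity)))
  filter_upwards [hb.eventually_ge_atTop 1, hW.abs.eventually_const_lt hdw] with n h1 h2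
  exact le_psiStar_exp hA h1 hd.le h2.le

theorem ae_abs_le_of_lintegral_psiStar_le {A : ℝ} (hA : 0 < A) {X : Type*} [MeasurableSpace X]
    {μ : Measure X} {b : ℕ → ℝ} {W : ℕ → X → ℝ} {w : X → ℝ} {c : ENNReal} (hc : c ≠ ⊤)
    (hb : Tendsto b atTop atTop)
    (hWm : ∀ n, AEStronglyMeasurable (W n) μ)
    (hW : ∀ᵐ t ∂μ, Tendsto (fun n => W n t) atTop (𝓝 (w t)))
    (hbound : ∀ n, ∫⁻ t, ENNReal.ofReal (psiStar (Real.exp (-b n * A)) (b n) (W n t)) ∂μ ≤ c) :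
    ∀ᵐ t ∂μ, |w t| ≤ A := by
  have hmeas (n : ℕ) : AEMeasurable
      (fun t => ENNReal.ofReal (psiStar (Real.exp (-b n * A)) (b n) (W n t))) μ := by
    have : Continuous fun w : ℝ => psiStar (Real.exp (-b n * A)) (b n) w := by
      unfold psiStar
      fun_prop
    exact (this.comp_aestronglyMeasurable (hWm n)).aemeasurable.ennreal_ofReal
  have hfatou : ∫⁻ t, liminf (fun n => ENNReal.ofReal
      (psiStar (Real.exp (-b n * A)) (b n) (W n t))) atTop ∂μ ≤ c := by
    refine (lintegral_liminf_le' hmeas).trans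
      ((liminf_le_liminf (Eventually.of_forall hbound)).trans ?_)
    simp
  have hmeas_liminf : AEMeasurable (fun t => liminf (fun n => ENNReal.ofReal
      (psiStar (Real.exp (-b n * A)) (b n) (W n t))) atTop) μ := by
    simp only [liminf_eq_iSup_iInf_of_nat]
    exact .iSup fun n => .biInf _ (to_countable _) fun i _ => hmeas i
  filter_upwards [ae_lt_top' hmeas_liminf (ne_top_of_le_ne_top hc hfatou), hW] with t ht hWt
  by_contra! hwt
  exact ht.ne (ENNReal.tendsto_ofReal_atTop.comp
    (psiStar_exp_tendsto_atTop hA hwt hb hWt)).liminf_eq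

theorem tendsto_integral_comp_curve {T M : ℝ} (hT : 0 ≤ T) {F : ℝ → ℝ → ℝ}
    (hF : Continuous fun p : ℝ × ℝ => F p.1 p.2) {y y' : ℕ → ℝ → ℝ} {x : ℝ → ℝ}
    (hy' : ∀ n, IntegrableOn (y' n) (Ioo 0 T))
    (hy : ∀ n, ∀ t ∈ Icc 0 T, y n t = y n 0 + ∫ s in (0 : ℝ)..t, y' n s)
    (hM : ∀ n, ∀ t ∈ Icc 0 T, |y n t| ≤ M)
    (hlim : ∀ t ∈ Icc 0 T, Tendsto (fun n => y n t) atTop (𝓝 (x t))) :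
    (∀ n, IntegrableOn (fun t => F (y n t) t) (Ioo 0 T)) ∧
      Tendsto (fun n => ∫ t in Ioo 0 T, F (y n t) t) atTop (𝓝 (∫ t in Ioo 0 T, F (x t) t)) := by
  obtain ⟨K, -, hK⟩ := exists_bound_on_box hF M T
  have hm (n : ℕ) := aestronglyMeasurable_comp_curve hT hF (hy' n) (hy n)
  have hbd (n : ℕ) : ∀ᵐ t ∂(volume.restrict (Ioo 0 T)), ‖F (y n t) t‖ ≤ K := by
    filter_upwards [ae_restrict_mem measurableSet_Ioo] with t ht
    have htI := Ioo_subset_Icc_self ht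
    exact hK _ t (hM n t htI) htI
  have hKint : IntegrableOn (fun _ : ℝ => K) (Ioo 0 T) := integrableOn_const (by simp)
  refine ⟨fun n => Integrable.mono' hKint (hm n) (hbd n),
    tendsto_integral_of_dominated_convergence (fun _ => K) hm hKint hbd ?_⟩
  filter_upwards [ae_restrict_mem measurableSet_Ioo] with t ht
  exact (hF.tendsto (x t, t)).comp
    ((hlim t (Ioo_subset_Icc_self ht)).prodMk_nhds tendsto_const_nhds)

theorem exists_uniform_bound {T C : ℝ} {y y' : ℕ → ℝ → ℝ} {x₀ : ℝ}
    (hy' : ∀ n, IntegrableOn (y' n) (Ioo 0 T))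
    (hy : ∀ n, ∀ t ∈ Icc 0 T, y n t = y n 0 + ∫ s in (0 : ℝ)..t, y' n s)
    (hC : ∀ n, ∫ t in Ioo 0 T, |y' n t| ≤ C)
    (hlim : Tendsto (fun n => y n 0) atTop (𝓝 x₀)) :
    ∃ M, ∀ n, ∀ t ∈ Icc 0 T, |y n t| ≤ M := by
  obtain ⟨B, hB⟩ := hlim.abs.bddAbove_range
  exact ⟨B + C, fun n t ht => (abs_le_of_eq_primitive (hy' n) (hy n) ht).trans
    (add_le_add (hB ⟨n, rfl⟩) (hC n))⟩

/-- The energy-dissipation lower bound for the rate functional along one curve. -/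
theorem dissipation_add_energy_le_of_lintegral_rate_le {T : ℝ} (hT : 0 ≤ T)
    {E DE Et : ℝ → ℝ → ℝ} {R : ℝ}
    (hDEcont : Continuous fun p : ℝ × ℝ => DE p.1 p.2)
    (hEtcont : Continuous fun p : ℝ × ℝ => Et p.1 p.2)
    (hDE : ∀ y t, HasDerivAt (fun z => E z t) (DE y t) y)
    (hEt : ∀ y t, HasDerivAt (fun τ => E y τ) (Et y t) t)
    (hDEbound : ∀ y t, |DE y t| ≤ R)
    {A b : ℝ} (hA : 0 < A) (hb : 0 < b)
    {y y' : ℝ → ℝ} (hy' : IntegrableOn y' (Ioo 0 T))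
    (hy : ∀ t ∈ Icc 0 T, y t = y 0 + ∫ s in (0 : ℝ)..t, y' s)
    (hEtint : IntegrableOn (fun t => Et (y t) t) (Ioo 0 T))
    {c : ENNReal} (hc : c ≠ ⊤)
    (hbound : ∫⁻ t in Ioo 0 T, ENNReal.ofReal (psi (Real.exp (-b * A)) b (y' t)
      + psiStar (Real.exp (-b * A)) b (DE (y t) t) + y' t * DE (y t) t) ≤ c) :
    A * (∫ t in Ioo 0 T, |y' t|) - 2 / b * T
      + (E (y T) T - E (y 0) 0 - ∫ t in Ioo 0 T, Et (y t) t) ≤ c.toReal := by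
  have hprod : IntegrableOn (fun t => y' t * DE (y t) t) (Ioo 0 T) :=
    hy'.mul_bdd (aestronglyMeasurable_comp_curve hT hDEcont hy' hy)
      (ae_of_all _ fun t => hDEbound (y t) t)
  have hchain := integral_chain_rule hT hDEcont hEtcont hDE hEt hDEbound hy' hy
  rw [integral_add hprod hEtint] at hchain
  have hconst : IntegrableOn (fun _ : ℝ => 2 / b) (Ioo 0 T) := integrableOn_const (by simp)
  have habs : IntegrableOn (fun t => A * |y' t|) (Ioo 0 T) := hy'.abs.const_mul A
  have hsub : IntegrableOn (fun t => A * |y' t| - 2 / b) (Ioo 0 T) := habs.sub hconst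
  have hint : IntegrableOn (fun t => A * |y' t| - 2 / b + y' t * DE (y t) t) (Ioo 0 T) :=
    hsub.add hprod
  have hle : ∫ t in Ioo 0 T, (A * |y' t| - 2 / b + y' t * DE (y t) t) ≤ c.toReal := by
    refine (ENNReal.ofReal_le_iff_le_toReal hc).1
      ((ofReal_integral_le_lintegral_ofReal hint).trans (le_trans ?_ hbound))
    refine lintegral_mono fun t => ENNReal.ofReal_le_ofReal ?_
    linarith [mul_abs_sub_le_psi hA hb (y' t),
      psiStar_nonneg (Real.exp_pos (-b * A)) hb (DE (y t) t)]
  have heq : ∫ t in Ioo 0 T, (A * |y' t| - 2 / b + y' t * DE (y t) t) =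
      A * (∫ t in Ioo 0 T, |y' t|) - 2 / b * T + ∫ t in Ioo 0 T, y' t * DE (y t) t := by
    rw [integral_add hsub hprod, integral_sub habs hconst, integral_const_mul]
    simp [hT, mul_comm]
  linarith

theorem lintegral_psiStar_le_add {T : ℝ} {DE : ℝ → ℝ → ℝ} {R C a b : ℝ}
    (hR : 0 ≤ R) (hDEbound : ∀ y t, |DE y t| ≤ R) (ha : 0 < a) (hb : 0 < b)
    {y y' : ℝ → ℝ} (hy' : IntegrableOn y' (Ioo 0 T)) (hC : ∫ t in Ioo 0 T, |y' t| ≤ C)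
    {c : ENNReal}
    (hbound : ∫⁻ t in Ioo 0 T, ENNReal.ofReal (psi a b (y' t)
      + psiStar a b (DE (y t) t) + y' t * DE (y t) t) ≤ c) :
    ∫⁻ t in Ioo 0 T, ENNReal.ofReal (psiStar a b (DE (y t) t)) ≤ c + ENNReal.ofReal (R * C) := by
  have habs : IntegrableOn (fun t => R * |y' t|) (Ioo 0 T) := hy'.abs.const_mul R
  calc ∫⁻ t in Ioo 0 T, ENNReal.ofReal (psiStar a b (DE (y t) t))
      ≤ ∫⁻ t in Ioo 0 T, (ENNReal.ofReal (psi a b (y' t)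
          + psiStar a b (DE (y t) t) + y' t * DE (y t) t) + ENNReal.ofReal (R * |y' t|)) :=
        lintegral_mono fun t => (ENNReal.ofReal_le_ofReal
          (psiStar_le_rate_add ha hb (hDEbound (y t) t))).trans ENNReal.ofReal_add_le
    _ = (∫⁻ t in Ioo 0 T, ENNReal.ofReal (psi a b (y' t)
          + psiStar a b (DE (y t) t) + y' t * DE (y t) t))
          + ∫⁻ t in Ioo 0 T, ENNReal.ofReal (R * |y' t|) :=
        lintegral_add_right' _ habs.aestronglyMeasurable.aemeasurable.ennreal_ofReal
    _ ≤ c + ENNReal.ofReal (R * C) := by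
        rw [← ofReal_integral_eq_lintegral_ofReal habs (ae_of_all _ fun t => by positivity),
          integral_const_mul]
        gcongr

/-- Both conclusions of the liminf inequality along a sequence whose rate functionals are all
bounded by `c`. -/
theorem ae_abs_le_and_energy_le_of_lintegral_rate_le
    {T : ℝ} (hT : 0 ≤ T) {E DE Et : ℝ → ℝ → ℝ} {R C : ℝ}
    (hEcont : Continuous fun p : ℝ × ℝ => E p.1 p.2)
    (hDEcont : Continuous fun p : ℝ × ℝ => DE p.1 p.2)
    (hEtcont : Continuous fun p : ℝ × ℝ => Et p.1 p.2)
    (hDE : ∀ y t, HasDerivAt (fun z => E z t) (DE y t) y)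
    (hEt : ∀ y t, HasDerivAt (fun τ => E y τ) (Et y t) t)
    (hDEbound : ∀ y t, |DE y t| ≤ R)
    {A : ℝ} (hA : 0 < A) {b : ℕ → ℝ} (hbpos : ∀ n, 0 < b n) (hb : Tendsto b atTop atTop)
    {y y' : ℕ → ℝ → ℝ} {x x' : ℝ → ℝ}
    (hy' : ∀ n, IntegrableOn (y' n) (Ioo 0 T))
    (hy : ∀ n, ∀ t ∈ Icc 0 T, y n t = y n 0 + ∫ s in (0 : ℝ)..t, y' n s)
    (hx' : IntegrableOn x' (Ioo 0 T))
    (hx : ∀ t ∈ Icc 0 T, x t = x 0 + ∫ s in (0 : ℝ)..t, x' s)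
    (hC : ∀ n, ∫ t in Ioo 0 T, |y' n t| ≤ C)
    (hlim : ∀ t ∈ Icc 0 T, Tendsto (fun n => y n t) atTop (𝓝 (x t)))
    {c : ENNReal} (hc : c ≠ ⊤)
    (hbound : ∀ n, ∫⁻ t in Ioo 0 T, ENNReal.ofReal (psi (Real.exp (-b n * A)) (b n) (y' n t)
      + psiStar (Real.exp (-b n * A)) (b n) (DE (y n t) t) + y' n t * DE (y n t) t) ≤ c) :
    (∀ᵐ t ∂(volume.restrict (Ioo 0 T)), |DE (x t) t| ≤ A) ∧
      A * (∫ t in Ioo 0 T, |x' t|) + E (x T) T - E (x 0) 0 - ∫ t in Ioo 0 T, Et (x t) t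
        ≤ c.toReal := by
  have h0 : (0 : ℝ) ∈ Icc 0 T := ⟨le_rfl, hT⟩
  have hTT : T ∈ Icc 0 T := ⟨hT, le_rfl⟩
  have hcomp {F : ℝ → ℝ → ℝ} (hF : Continuous fun p : ℝ × ℝ => F p.1 p.2) {t : ℝ}
      (ht : t ∈ Icc 0 T) : Tendsto (fun n => F (y n t) t) atTop (𝓝 (F (x t) t)) :=
    (hF.tendsto (x t, t)).comp ((hlim t ht).prodMk_nhds tendsto_const_nhds)
  constructor
  · refine ae_abs_le_of_lintegral_psiStar_le hA (ENNReal.add_ne_top.2 ⟨hc, ENNReal.ofReal_ne_top⟩)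
      hb (fun n => aestronglyMeasurable_comp_curve hT hDEcont (hy' n) (hy n)) ?_
      fun n => lintegral_psiStar_le_add ((abs_nonneg _).trans (hDEbound 0 0)) hDEbound
        (Real.exp_pos _) (hbpos n) (hy' n) (hC n) (hbound n)
    filter_upwards [ae_restrict_mem measurableSet_Ioo] with t ht
    exact hcomp hDEcont (Ioo_subset_Icc_self ht)
  · obtain ⟨M, hM⟩ := exists_uniform_bound hy' hy hC (hlim 0 h0)
    obtain ⟨hEtint, hEtlim⟩ := tendsto_integral_comp_curve hT hEtcont hy' hy hM hlim
    have hBlim : Tendsto (fun n => 2 / b n * T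
        - (E (y n T) T - E (y n 0) 0 - ∫ t in Ioo 0 T, Et (y n t) t)) atTop
        (𝓝 (0 * T - (E (x T) T - E (x 0) 0 - ∫ t in Ioo 0 T, Et (x t) t))) :=
      ((hb.const_div_atTop 2).mul_const T).sub
        (((hcomp hEcont hTT).sub (hcomp hEcont h0)).sub hEtlim)
    have hprim (t : ℝ) (ht : t ∈ Icc 0 T) : Tendsto (fun n => ∫ s in (0 : ℝ)..t, y' n s) atTop
        (𝓝 (∫ s in (0 : ℝ)..t, x' s)) := by
      have h := (hlim t ht).sub (hlim 0 h0)
      rw [hx t ht, add_sub_cancel_left] at h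
      refine h.congr fun n => ?_
      rw [hy n t ht, add_sub_cancel_left]
    refine le_of_forall_pos_le_add fun ε hε => ?_
    have hev := hBlim.eventually_lt_const (lt_add_of_pos_right _ hε)
    have hx'le := integral_abs_le_of_tendsto_primitive hT hy' hx' hprim
      (C := (c.toReal + (0 * T - (E (x T) T - E (x 0) 0 - ∫ t in Ioo 0 T, Et (x t) t) + ε)) / A)
      (hev.mono fun n hn => by
        have := dissipation_add_energy_le_of_lintegral_rate_le hT hDEcont hEtcont hDE hEt
          hDEbound hA (hbpos n) (hy' n) (hy n) (hEtint n) hc (hbound n)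
        rw [le_div_iff₀ hA]
        linarith)
    rw [le_div_iff₀ hA] at hx'le
    linarith

/-- liminf inequality in the rate-independent limit, for absolutely
continuous limits: let `A > 0`, `β_n → ∞`, `α_n = e^{−β_n A}`, let `x_n ∈ W^{1,1}(0,T)`
with `sup_n ∫₀ᵀ |ẋ_n| < ∞` and `x_n(t) → x(t)` for every `t ∈ [0,T]` with
`x ∈ W^{1,1}(0,T)`, and suppose `liminf_n J_{α_n,β_n}(x_n) < ∞`.  Then
`|∇E(x(t),t)| ≤ A` for a.e. `t ∈ (0,T)` and
`liminf_n J_{α_n,β_n}(x_n) ≥ A ∫₀ᵀ |ẋ| + E(x(T),T) − E(x(0),0) − ∫₀ᵀ ∂_t E(x(t),t) dt`. -/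
theorem rate_independent_liminf
    (T : ℝ) (hT : 0 < T)
    -- the energy `E`, spatial derivative `∇E = DE`, time derivative `∂_t E = Et`
    (E DE Et : ℝ → ℝ → ℝ) (R L : ℝ)
    (hEcont : Continuous fun p : ℝ × ℝ => E p.1 p.2)
    (hDEcont : Continuous fun p : ℝ × ℝ => DE p.1 p.2)
    (hEtcont : Continuous fun p : ℝ × ℝ => Et p.1 p.2)
    (hDE : ∀ y t, HasDerivAt (fun z => E z t) (DE y t) y)
    (hEt : ∀ y t, HasDerivAt (fun τ => E y τ) (Et y t) t)
    (hEnonneg : ∀ y t, 0 ≤ E y t)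
    (hDEbound : ∀ y t, |DE y t| ≤ R)
    (hDELip : ∀ y s t, |DE y t - DE y s| ≤ L * |t - s|)
    -- the scaling regime
    (A : ℝ) (hA : 0 < A)
    (β : ℕ → ℝ) (hβpos : ∀ n, 0 < β n) (hβ : Tendsto β atTop atTop)
    -- the curves `x_n` and `x` in `W^{1,1}(0,T)`
    (xn xn' : ℕ → ℝ → ℝ) (x x' : ℝ → ℝ)
    (hxn'int : ∀ n, IntegrableOn (xn' n) (Set.Ioo 0 T))
    (hxnac : ∀ n, ∀ t ∈ Set.Icc 0 T, xn n t = xn n 0 + ∫ s in (0:ℝ)..t, xn' n s)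
    (hx'int : IntegrableOn x' (Set.Ioo 0 T))
    (hxac : ∀ t ∈ Set.Icc 0 T, x t = x 0 + ∫ s in (0:ℝ)..t, x' s)
    (hEtint : IntegrableOn (fun s => Et (x s) s) (Set.Ioo 0 T))
    -- uniform bound on the total variations, and pointwise convergence on [0,T]
    (hbd : ∃ C : ℝ, ∀ n, (∫ t in Set.Ioo 0 T, |xn' n t|) ≤ C)
    (hptw : ∀ t ∈ Set.Icc 0 T, Tendsto (fun n => xn n t) atTop (𝓝 (x t)))
    -- finiteness of the liminf of the rate functionals
    (hfin : Filter.liminf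
        (fun n => ∫⁻ t in Set.Ioo 0 T, ENNReal.ofReal
          (psi (Real.exp (-β n * A)) (β n) (xn' n t)
            + psiStar (Real.exp (-β n * A)) (β n) (DE (xn n t) t)
            + xn' n t * DE (xn n t) t))
        Filter.atTop < ⊤) :
    (∀ᵐ t ∂(volume.restrict (Set.Ioo 0 T)), |DE (x t) t| ≤ A) ∧
    ENNReal.ofReal
        (A * (∫ t in Set.Ioo 0 T, |x' t|) + E (x T) T - E (x 0) 0
          - ∫ t in Set.Ioo 0 T, Et (x t) t) ≤
      Filter.liminf
        (fun n => ∫⁻ t in Set.Ioo 0 T, ENNReal.ofReal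
          (psi (Real.exp (-β n * A)) (β n) (xn' n t)
            + psiStar (Real.exp (-β n * A)) (β n) (DE (xn n t) t)
            + xn' n t * DE (xn n t) t))
        Filter.atTop := by
  obtain ⟨C, hC⟩ := hbd
  have hsub {c : ENNReal} (hc : c ≠ ⊤) (hlt : Filter.liminf
      (fun n => ∫⁻ t in Set.Ioo 0 T, ENNReal.ofReal
        (psi (Real.exp (-β n * A)) (β n) (xn' n t)
          + psiStar (Real.exp (-β n * A)) (β n) (DE (xn n t) t)
          + xn' n t * DE (xn n t) t)) Filter.atTop < c) :
      (∀ᵐ t ∂(volume.restrict (Ioo 0 T)), |DE (x t) t| ≤ A) ∧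
        A * (∫ t in Ioo 0 T, |x' t|) + E (x T) T - E (x 0) 0 - ∫ t in Ioo 0 T, Et (x t) t
          ≤ c.toReal := by
    obtain ⟨φ, hφ, hφc⟩ := extraction_of_frequently_atTop
      (frequently_lt_of_liminf_lt (by isBoundedDefault) hlt)
    exact ae_abs_le_and_energy_le_of_lintegral_rate_le hT.le hEcont hDEcont hEtcont hDE hEt
      hDEbound hA (fun n => hβpos (φ n)) (hβ.comp hφ.tendsto_atTop) (fun n => hxn'int (φ n))
      (fun n => hxnac (φ n)) hx'int hxac (fun n => hC (φ n))
      (fun t ht => (hptw t ht).comp hφ.tendsto_atTop) hc fun n => (hφc n).le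
  constructor
  · obtain ⟨c, hlt, hc⟩ := exists_between hfin
    exact (hsub hc.ne hlt).1
  · refine le_of_forall_gt_imp_ge_of_dense fun c hlt => ?_
    rcases eq_or_ne c ⊤ with rfl | hc
    · exact le_top
    · exact (ENNReal.ofReal_le_iff_le_toReal hc).2 (hsub hc hlt).2
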